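/- arXiv:2305.06484 — 4 statements merged into one kernel-verified Lean document; each statement's English description precedes it below -/
import Mathlib

section
/- Let X and Y be separable metric spaces and let ν be a Markov kernel from X to Y that is weakly continuous. If (Q_n) is a sequence of Borel probability measures on X converging weakly to a Borel probability measure Q, then the joint measures converge weakly on X × Y: Q_n ⊗ ν ⇒ Q ⊗ ν. -/
open MeasureTheory ProbabilityTheory Filter
open scoped ProbabilityTheory

/-- Integrating the second variable of a bounded function, Lipschitz on the product, against a
sequentially weakly continuous Markov kernel gives a continuous function of the first variable. -/
lemma continuous_integral_kernel_of_lipschitz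
    {X Y : Type*} [MetricSpace X] [MeasurableSpace X]
    [MetricSpace Y] [MeasurableSpace Y] [BorelSpace Y]
    (ν : Kernel X Y) [IsMarkovKernel ν]
    (hν : ∀ (x : X) (u : ℕ → X), Tendsto u atTop (nhds x) →
      ∀ g : BoundedContinuousFunction Y ℝ,
        Tendsto (fun n => ∫ y, g y ∂(ν (u n))) atTop (nhds (∫ y, g y ∂(ν x))))
    (F : BoundedContinuousFunction (X × Y) ℝ) {L : NNReal} (hF : LipschitzWith L F) :
    Continuous fun x => ∫ y, F (x, y) ∂(ν x) := by
  let slice (x : X) : BoundedContinuousFunction Y ℝ :=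
    F.compContinuous ⟨fun y => (x, y), by fun_prop⟩
  have hslice (x z : X) : Integrable (fun y => F (x, y)) (ν z) := (slice x).integrable (ν z)
  rw [continuous_iff_seqContinuous]
  intro u x hu
  have hdiff : Tendsto (fun n => ∫ y, F (u n, y) ∂(ν (u n)) - ∫ y, F (x, y) ∂(ν (u n)))
      atTop (nhds 0) := by
    refine squeeze_zero_norm (a := fun n => L * dist (u n) x) (fun n => ?_) ?_
    · rw [← integral_sub (hslice _ _) (hslice _ _)]
      refine (norm_integral_le_of_norm_le_const (C := L * dist (u n) x)
        (Eventually.of_forall fun y => ?_)).trans_eq (by simp)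
      simpa [← dist_eq_norm, Prod.dist_eq] using hF.dist_le_mul (u n, y) (x, y)
    · simpa using (tendsto_iff_dist_tendsto_zero.1 hu).const_mul (L : ℝ)
  simpa [Function.comp_def, slice] using hdiff.add (hν x u hu (slice x))

/-- If `ν` is a weakly continuous Markov kernel from a separable metric
space `X` to a separable metric space `Y` and `Q_n ⇒ Q` weakly, then `Q_n ⊗ ν ⇒ Q ⊗ ν`
weakly on `X × Y`. -/
theorem weaklyContinuousKernel_compProd_tendsto
    {X Y : Type*}
    [MetricSpace X] [TopologicalSpace.SeparableSpace X]
    [MeasurableSpace X] [BorelSpace X]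
    [MetricSpace Y] [TopologicalSpace.SeparableSpace Y]
    [MeasurableSpace Y] [BorelSpace Y]
    (ν : Kernel X Y) [IsMarkovKernel ν]
    (hν : ∀ (x : X) (u : ℕ → X), Tendsto u atTop (nhds x) →
      ∀ g : BoundedContinuousFunction Y ℝ,
        Tendsto (fun n => ∫ y, g y ∂(ν (u n))) atTop (nhds (∫ y, g y ∂(ν x))))
    (Q : Measure X) [IsProbabilityMeasure Q]
    (Qn : ℕ → Measure X) [∀ n, IsProbabilityMeasure (Qn n)]
    (hQ : ∀ f : BoundedContinuousFunction X ℝ,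
      Tendsto (fun n => ∫ x, f x ∂(Qn n)) atTop (nhds (∫ x, f x ∂Q))) :
    ∀ F : BoundedContinuousFunction (X × Y) ℝ,
      Tendsto (fun n => ∫ p, F p ∂(Qn n ⊗ₘ ν)) atTop (nhds (∫ p, F p ∂(Q ⊗ₘ ν))) := by
  have := UniformSpace.secondCountable_of_separable X
  let P (μ : Measure X) [IsProbabilityMeasure μ] : ProbabilityMeasure (X × Y) :=
    ⟨μ ⊗ₘ ν, inferInstance⟩
  suffices h : Tendsto (fun n => P (Qn n)) atTop (nhds (P Q)) from
    ProbabilityMeasure.tendsto_iff_forall_integral_tendsto.1 h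
  rw [tendsto_iff_forall_lipschitz_integral_tendsto]
  rintro f ⟨C, hC⟩ ⟨L, hL⟩
  let F : BoundedContinuousFunction (X × Y) ℝ := ⟨⟨f, hL.continuous⟩, C, hC⟩
  let G : BoundedContinuousFunction X ℝ :=
    BoundedContinuousFunction.ofNormedAddCommGroup (fun x => ∫ y, F (x, y) ∂(ν x))
      (continuous_integral_kernel_of_lipschitz ν hν F hL) ‖F‖ fun x =>
        (norm_integral_le_of_norm_le_const (Eventually.of_forall fun y =>
          F.norm_coe_le_norm (x, y))).trans_eq (by simp)
  have hG (μ : Measure X) [IsProbabilityMeasure μ] : ∫ p, f p ∂(μ ⊗ₘ ν) = ∫ x, G x ∂μ :=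
    Measure.integral_compProd (F.integrable (μ ⊗ₘ ν))
  simpa only [P, ProbabilityMeasure.coe_mk, hG] using hQ G
end

section
/- Let X and Y be separable metric spaces and let ν be a Markov kernel from X to Y that is weakly continuous. If (Q_n) is a sequence of Borel probability measures on X converging weakly to Q, then liminf_{n→∞} D(Q_n ⊗ ν ‖ Q_n × M_{Q_n}) ≥ D(Q ⊗ ν ‖ Q × M_Q), where the divergences take values in [0,∞]. -/
open MeasureTheory ProbabilityTheory Filter
open scoped ProbabilityTheory ENNReal Classical

/-- The Kullback–Leibler divergence `D(P‖M)`, with values in `[0,∞]`: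
`∫ log (dP/dM) dP` if `P ≪ M` (and the integral makes sense), `∞` otherwise. -/
noncomputable def klDiv {α : Type*} [MeasurableSpace α] (P M : Measure α) : ℝ≥0∞ :=
  if P ≪ M ∧ Integrable (llr P M) P then ENNReal.ofReal (∫ x, llr P M x ∂P) else ⊤

open InformationTheory (klFun klFun_apply klFun_zero klFun_nonneg integrable_klFun_rnDeriv_iff)
open scoped Topology BoundedContinuousFunction

/-- The convex-duality (Fenchel–Young) inequality for `klFun`. -/
lemma mul_add_one_sub_exp_le_klFun {r : ℝ} (hr : 0 ≤ r) (t : ℝ) :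
    r * t + (1 - Real.exp t) ≤ klFun r := by
  rcases hr.eq_or_lt with rfl | hr
  · simp [klFun_zero, (Real.exp_pos t).le]
  · have h := mul_le_mul_of_nonneg_left (Real.add_one_le_exp (t - Real.log r)) hr.le
    rw [Real.exp_sub, Real.exp_log hr, mul_div_cancel₀ _ hr.ne'] at h
    rw [klFun_apply]
    linarith

/-- Truncations of `log` from both sides, used as approximate maximizers in the duality formula. -/
noncomputable def truncLog (n : ℕ) (r : ℝ) : ℝ :=
  Real.log (max (1 / ((n : ℝ) + 1)) (min r (n + 1)))

lemma truncLog_arg_pos (n : ℕ) (r : ℝ) : 0 < max (1 / ((n : ℝ) + 1)) (min r (n + 1)) :=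
  lt_max_of_lt_left (by positivity)

lemma measurable_truncLog (n : ℕ) : Measurable (truncLog n) := by
  unfold truncLog
  fun_prop

lemma abs_truncLog_le (n : ℕ) (r : ℝ) : |truncLog n r| ≤ Real.log (n + 1) := by
  have hn : (1 : ℝ) ≤ n + 1 := by linarith [n.cast_nonneg (α := ℝ)]
  have hinv : 1 / ((n : ℝ) + 1) ≤ n + 1 := by
    rw [div_le_iff₀ (by positivity)]
    nlinarith
  rw [abs_le]
  constructor
  · rw [← Real.log_inv, ← one_div]
    exact Real.log_le_log (by positivity) (le_max_left _ _)
  · exact Real.log_le_log (truncLog_arg_pos n r) (max_le hinv (min_le_right _ _))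

lemma mul_truncLog_add_nonneg (n : ℕ) (r : ℝ) :
    0 ≤ r * truncLog n r + (1 - Real.exp (truncLog n r)) := by
  have hn : (1 : ℝ) ≤ n + 1 := by linarith [n.cast_nonneg (α := ℝ)]
  have hinv : 1 / ((n : ℝ) + 1) ≤ 1 := by
    rw [div_le_iff₀ (by positivity)]
    linarith
  set m := max (1 / ((n : ℝ) + 1)) (min r (n + 1)) with hm
  have hm0 : 0 < m := truncLog_arg_pos n r
  have hexp : Real.exp (truncLog n r) = m := Real.exp_log hm0
  have hself : 0 ≤ m * Real.log m + (1 - m) := by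
    have := klFun_nonneg hm0.le
    rw [klFun_apply] at this
    linarith
  have hcmp : m * Real.log m ≤ r * Real.log m := by
    rcases le_total r 1 with h1 | h1
    · have hrm : r ≤ m := by
        rw [hm, min_eq_left (h1.trans hn)]
        exact le_max_right _ _
      have hm1 : m ≤ 1 := by
        rw [hm, min_eq_left (h1.trans hn)]
        exact max_le hinv h1
      exact mul_le_mul_of_nonpos_right hrm (Real.log_nonpos hm0.le hm1)
    · have hm1 : 1 ≤ m := (le_min h1 hn).trans (le_max_right _ _)
      have hmr : m ≤ r := max_le (hinv.trans h1) (min_le_left _ _)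
      exact mul_le_mul_of_nonneg_right hmr (Real.log_nonneg hm1)
  rw [hexp]
  change 0 ≤ r * Real.log m + (1 - m)
  linarith

lemma tendsto_mul_truncLog_add {r : ℝ} (hr : 0 ≤ r) :
    Tendsto (fun n ↦ r * truncLog n r + (1 - Real.exp (truncLog n r))) atTop (𝓝 (klFun r)) := by
  have hlim : Tendsto (fun n : ℕ ↦ 1 / ((n : ℝ) + 1)) atTop (𝓝 0) :=
    tendsto_one_div_add_atTop_nhds_zero_nat
  rcases hr.eq_or_lt with rfl | hr
  · have hexp (n : ℕ) : Real.exp (truncLog n 0) = 1 / ((n : ℝ) + 1) := by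
      rw [truncLog, Real.exp_log (truncLog_arg_pos n 0), min_eq_left (by positivity),
        max_eq_left (by positivity)]
    simp only [hexp, zero_mul, zero_add, klFun_zero]
    simpa using hlim.const_sub 1
  · refine tendsto_const_nhds.congr' ?_
    have hlarge : ∀ᶠ n : ℕ in atTop, r ≤ n := by
      obtain ⟨N, hN⟩ := exists_nat_ge r
      filter_upwards [eventually_ge_atTop N] with n hn
      exact hN.trans (by exact_mod_cast hn)
    filter_upwards [hlim.eventually_lt_const hr, hlarge] with n h1 h2
    rw [truncLog, min_eq_left (by linarith), max_eq_right h1.le, Real.exp_log hr, klFun_apply]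
    ring

section DualFormula

variable {α : Type*} [MeasurableSpace α]

lemma Measurable.integrable_of_abs_le {P : Measure α} [IsFiniteMeasure P] {f : α → ℝ} {K : ℝ}
    (hf : Measurable f) (hK : ∀ x, |f x| ≤ K) : Integrable f P :=
  Integrable.of_bound hf.aestronglyMeasurable K (ae_of_all _ hK)

lemma Measurable.integrable_exp_of_abs_le {P : Measure α} [IsFiniteMeasure P] {f : α → ℝ} {K : ℝ}
    (hf : Measurable f) (hK : ∀ x, |f x| ≤ K) : Integrable (fun x ↦ Real.exp (f x)) P := by
  refine (hf.exp).integrable_of_abs_le (K := Real.exp K) fun x ↦ ?_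
  rw [Real.abs_exp]
  exact Real.exp_le_exp.2 (le_of_abs_le (hK x))

/-- The dual functional whose supremum over bounded `f` is the Kullback–Leibler divergence. -/
noncomputable def klDual (P M : Measure α) (f : α → ℝ) : ℝ :=
  ∫ x, f x ∂P + ∫ x, (1 - Real.exp (f x)) ∂M

variable {P M : Measure α} [IsFiniteMeasure P] [IsFiniteMeasure M]

lemma integrable_rnDeriv_mul_add {f : α → ℝ} {K : ℝ} (hf : Measurable f) (hK : ∀ x, |f x| ≤ K) :
    Integrable (fun x ↦ (P.rnDeriv M x).toReal * f x) M ∧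
      Integrable (fun x ↦ 1 - Real.exp (f x)) M := by
  refine ⟨?_, (integrable_const _).sub (hf.integrable_exp_of_abs_le hK)⟩
  exact Measure.integrable_toReal_rnDeriv.mul_bdd (c := K) hf.aestronglyMeasurable (ae_of_all _ hK)

lemma klDual_eq_integral {f : α → ℝ} {K : ℝ} (hPM : P ≪ M)
    (hf : Measurable f) (hK : ∀ x, |f x| ≤ K) :
    klDual P M f = ∫ x, ((P.rnDeriv M x).toReal * f x + (1 - Real.exp (f x))) ∂M := by
  obtain ⟨h1, h2⟩ := integrable_rnDeriv_mul_add (P := P) (M := M) hf hK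
  rw [integral_add h1 h2, klDual, ← integral_rnDeriv_smul hPM]
  simp only [smul_eq_mul]

lemma ofReal_klDual_le_klDiv {f : α → ℝ} {K : ℝ} (hf : Measurable f) (hK : ∀ x, |f x| ≤ K) :
    ENNReal.ofReal (klDual P M f) ≤ InformationTheory.klDiv P M := by
  rw [InformationTheory.klDiv_eq_integral_klFun]
  split_ifs with h
  · obtain ⟨h1, h2⟩ := integrable_rnDeriv_mul_add (P := P) (M := M) hf hK
    rw [klDual_eq_integral h.1 hf hK]
    exact ENNReal.ofReal_le_ofReal (integral_mono (h1.add h2)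
      ((integrable_klFun_rnDeriv_iff h.1).2 h.2)
      fun x ↦ mul_add_one_sub_exp_le_klFun ENNReal.toReal_nonneg _)
  · exact le_top

lemma exists_measurable_lt_klDual {c : ℝ≥0∞} (hc : c < InformationTheory.klDiv P M) :
    ∃ (f : α → ℝ) (K : ℝ), Measurable f ∧ (∀ x, |f x| ≤ K) ∧
      c < ENNReal.ofReal (klDual P M f) := by
  by_cases hPM : P ≪ M
  · rw [InformationTheory.klDiv_eq_lintegral_klFun_of_ac hPM] at hc
    set r : α → ℝ := fun x ↦ (P.rnDeriv M x).toReal 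
    have hrm : Measurable r := by fun_prop
    have hr0 (x : α) : 0 ≤ r x := ENNReal.toReal_nonneg
    let g : ℕ → α → ℝ := fun n x ↦
      r x * truncLog n (r x) + (1 - Real.exp (truncLog n (r x))) 
    have hfm (n : ℕ) : Measurable fun x ↦ truncLog n (r x) := (measurable_truncLog n).comp hrm
    have hgm (n : ℕ) : Measurable (g n) := (hrm.mul (hfm n)).add ((hfm n).exp.const_sub 1)
    have hfatou := lintegral_liminf_le (μ := M) (u := atTop) fun n ↦ (hgm n).ennreal_ofReal
    have hlim (x : α) : liminf (fun n ↦ ENNReal.ofReal (g n x)) atTop =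
        ENNReal.ofReal (klFun (r x)) :=
      (ENNReal.tendsto_ofReal (tendsto_mul_truncLog_add (hr0 x))).liminf_eq
    simp only [hlim] at hfatou
    obtain ⟨n, hn⟩ := (eventually_lt_of_lt_liminf (hc.trans_le hfatou)).exists
    refine ⟨fun x ↦ truncLog n (r x), Real.log (n + 1), hfm n,
      fun x ↦ abs_truncLog_le n (r x), hn.trans_le ?_⟩
    obtain ⟨h1, h2⟩ := integrable_rnDeriv_mul_add (P := P) (M := M) (hfm n)
      fun x ↦ abs_truncLog_le n (r x)
    rw [klDual_eq_integral hPM (hfm n) fun x ↦ abs_truncLog_le n (r x)]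
    exact (ofReal_integral_eq_lintegral_ofReal (f := g n) (h1.add h2)
      (ae_of_all _ fun x ↦ mul_truncLog_add_nonneg n (r x))).symm.le
  · obtain ⟨s, hs, hMs, hPs⟩ : ∃ s, MeasurableSet s ∧ M s = 0 ∧ P s ≠ 0 := by
      by_contra! h
      exact hPM (Measure.AbsolutelyContinuous.mk h)
    have hcT : c ≠ ∞ := (hc.trans_le le_top).ne
    have hpos : 0 < P.real s := ENNReal.toReal_pos hPs (measure_ne_top _ _)
    obtain ⟨n, hn⟩ := exists_nat_gt (c.toReal / P.real s)
    rw [div_lt_iff₀ hpos] at hn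
    refine ⟨s.indicator fun _ ↦ (n : ℝ), n, measurable_const.indicator hs, fun x ↦ ?_, ?_⟩
    · by_cases hx : x ∈ s <;> simp [hx]
    · have hzero : ∫ x, (1 - Real.exp (s.indicator (fun _ ↦ (n : ℝ)) x)) ∂M = 0 := by
        refine integral_eq_zero_of_ae ?_
        filter_upwards [measure_eq_zero_iff_ae_notMem.1 hMs] with x hx
        simp [hx]
      rw [klDual, hzero, integral_indicator_const _ hs, add_zero, smul_eq_mul, mul_comm,
        ENNReal.lt_ofReal_iff_toReal_lt hcT]
      exact hn

end DualFormula

section LowerSemicontinuity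

variable {Ω : Type*} [TopologicalSpace Ω] [TopologicalSpace.PseudoMetrizableSpace Ω]
  [MeasurableSpace Ω] [BorelSpace Ω]

lemma exists_boundedContinuous_lt_klDual {P M : Measure Ω} [IsFiniteMeasure P] [IsFiniteMeasure M]
    {c : ℝ≥0∞} (hc : c < InformationTheory.klDiv P M) :
    ∃ f : Ω →ᵇ ℝ, c < ENNReal.ofReal (klDual P M f) := by
  obtain ⟨f, K, hf, hK, hcf⟩ := exists_measurable_lt_klDual hc
  have hcT : c ≠ ∞ := (hc.trans_le le_top).ne
  rw [ENNReal.lt_ofReal_iff_toReal_lt hcT] at hcf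
  set L := 1 + Real.exp K with hL
  have hL0 : 0 < L := by positivity
  set ε := (klDual P M f - c.toReal) / (2 * L) with hε
  have hε0 : 0 < ε := div_pos (sub_pos.2 hcf) (by positivity)
  obtain ⟨g, hg, -⟩ :=
    (hf.integrable_of_abs_le (P := P + M) hK).exists_boundedContinuous_integral_sub_le hε0
  let h : Ω → ℝ := fun x ↦ max (-K) (min K (g x))
  have hcont : Continuous h := by fun_prop
  have hhK (x : Ω) : |h x| ≤ K := by
    have : 0 ≤ K := (abs_nonneg _).trans (hK x)
    exact abs_le.2 ⟨le_max_left _ _, max_le (by linarith) (min_le_left _ _)⟩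
  have hfh (x : Ω) : |f x - h x| ≤ |f x - g x| := by
    have hx : f x = max (-K) (min K (f x)) := by
      rw [min_eq_right (abs_le.1 (hK x)).2, max_eq_right (abs_le.1 (hK x)).1]
    calc |f x - h x| = |max (-K) (min K (f x)) - max (-K) (min K (g x))| := by rw [← hx]
      _ ≤ |min K (f x) - min K (g x)| := by
        simpa using abs_max_sub_max_le_max (-K) (min K (f x)) (-K) (min K (g x))
      _ ≤ |f x - g x| := by
        simpa using abs_min_sub_min_le_max K (f x) K (g x)
  have hhm : Measurable h := hcont.measurable
  have hdiff {R : Measure Ω} [IsFiniteMeasure R] : Integrable (fun x ↦ |f x - g x|) R :=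
    ((hf.integrable_of_abs_le hK).sub (g.integrable R)).abs
  have hsum : ∫ x, |f x - g x| ∂P + ∫ x, |f x - g x| ∂M ≤ ε := by
    rw [← integral_add_measure hdiff hdiff]
    exact hg
  have hP : ∫ x, f x ∂P - ∫ x, h x ∂P ≤ ∫ x, |f x - g x| ∂P := by
    rw [← integral_sub (hf.integrable_of_abs_le hK) (hhm.integrable_of_abs_le hhK)]
    exact integral_mono ((hf.integrable_of_abs_le hK).sub (hhm.integrable_of_abs_le hhK)) hdiff
      fun x ↦ (le_abs_self _).trans (hfh x)
  have hM : ∫ x, (1 - Real.exp (f x)) ∂M - ∫ x, (1 - Real.exp (h x)) ∂M ≤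
      Real.exp K * ∫ x, |f x - g x| ∂M := by
    have h1 := (integrable_rnDeriv_mul_add (P := M) (M := M) hf hK).2
    have h2 := (integrable_rnDeriv_mul_add (P := M) (M := M) hhm hhK).2
    rw [← integral_sub h1 h2, ← integral_const_mul]
    refine integral_mono (h1.sub h2) (hdiff.const_mul _) fun x ↦ ?_
    have hlip := mul_le_mul_of_nonneg_left (Real.add_one_le_exp (f x - h x)) (Real.exp_pos (h x)).le
    rw [← Real.exp_add, add_sub_cancel] at hlip
    have hbd : Real.exp (h x) * (h x - f x) ≤ Real.exp K * |f x - g x| :=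
      mul_le_mul_of_nonneg (Real.exp_le_exp.2 (le_of_abs_le (hhK x)))
        (((le_abs_self _).trans_eq (abs_sub_comm _ _)).trans (hfh x)) (Real.exp_pos _).le
        (abs_nonneg _)
    change (1 - Real.exp (f x)) - (1 - Real.exp (h x)) ≤ _
    linarith
  refine ⟨BoundedContinuousFunction.ofNormedAddCommGroup h hcont K hhK, ?_⟩
  rw [ENNReal.lt_ofReal_iff_toReal_lt hcT]
  change c.toReal < klDual P M h
  have hLε : L * ε = (klDual P M f - c.toReal) / 2 := by
    rw [hε]
    field_simp
  have hI1 : 0 ≤ ∫ x, |f x - g x| ∂P := integral_nonneg fun _ ↦ abs_nonneg _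
  have hI2 : 0 ≤ ∫ x, |f x - g x| ∂M := integral_nonneg fun _ ↦ abs_nonneg _
  have hexp := Real.exp_pos K
  have hbound : klDual P M f - klDual P M h ≤ L * ε := by
    unfold klDual
    nlinarith
  linarith

/-- Joint lower semicontinuity of the Kullback–Leibler divergence under weak convergence. -/
theorem klDiv_le_liminf_klDiv {P M : ProbabilityMeasure Ω} {Pn Mn : ℕ → ProbabilityMeasure Ω}
    (hP : Tendsto Pn atTop (𝓝 P)) (hM : Tendsto Mn atTop (𝓝 M)) :
    InformationTheory.klDiv (P : Measure Ω) M ≤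
      liminf (fun n ↦ InformationTheory.klDiv (Pn n : Measure Ω) (Mn n)) atTop := by
  refine le_of_forall_lt fun c hc ↦ ?_
  obtain ⟨d, hcd, hd⟩ := exists_between hc
  refine hcd.trans_le ?_
  obtain ⟨f, hf⟩ := exists_boundedContinuous_lt_klDual hd
  have hK (x : Ω) : |f x| ≤ ‖f‖ := f.norm_coe_le_norm x
  let e : Ω →ᵇ ℝ := BoundedContinuousFunction.ofNormedAddCommGroup
    (fun x ↦ 1 - Real.exp (f x)) (by fun_prop) (1 + Real.exp ‖f‖) fun x ↦ by
      refine (norm_sub_le _ _).trans ?_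
      rw [norm_one, Real.norm_eq_abs, Real.abs_exp]
      gcongr
      exact le_of_abs_le (hK x)
  have hlim : Tendsto (fun n ↦ klDual (Pn n : Measure Ω) (Mn n) f) atTop (𝓝 (klDual P M f)) :=
    (ProbabilityMeasure.tendsto_iff_forall_integral_tendsto.1 hP f).add
      (ProbabilityMeasure.tendsto_iff_forall_integral_tendsto.1 hM e)
  refine le_liminf_of_le (by isBoundedDefault) ?_
  filter_upwards [(ENNReal.tendsto_ofReal hlim).eventually_const_lt hf] with n hn
  exact hn.le.trans (ofReal_klDual_le_klDiv f.continuous.measurable hK)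

end LowerSemicontinuity

lemma klDiv_eq_informationTheory_klDiv {α : Type*} [MeasurableSpace α] (P M : Measure α)
    [IsProbabilityMeasure P] [IsProbabilityMeasure M] :
    klDiv P M = InformationTheory.klDiv P M := by
  rw [klDiv, InformationTheory.klDiv_def]
  simp

section CompProd

variable {X Y : Type*} [TopologicalSpace X] [TopologicalSpace.PseudoMetrizableSpace X]
  [SecondCountableTopology X] [MeasurableSpace X] [BorelSpace X]
  [TopologicalSpace Y] [TopologicalSpace.PseudoMetrizableSpace Y]
  [SecondCountableTopology Y] [MeasurableSpace Y] [BorelSpace Y]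

/-- A Markov kernel as a map into the space of probability measures. -/
noncomputable def kernelProba (ν : Kernel X Y) [IsMarkovKernel ν] (x : X) : ProbabilityMeasure Y :=
  ⟨ν x, inferInstance⟩

/-- The composition-product of a probability measure and a Markov kernel, as a probability
measure. -/
noncomputable def compProdProba (Q : ProbabilityMeasure X) (ν : Kernel X Y) [IsMarkovKernel ν] :
    ProbabilityMeasure (X × Y) :=
  ⟨(Q : Measure X) ⊗ₘ ν, inferInstance⟩

/-- Composition-products with a fixed weakly continuous Markov kernel preserve weak limits. -/
theorem tendsto_compProdProba (ν : Kernel X Y) [IsMarkovKernel ν]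
    (hν : Continuous (kernelProba ν))
    {Q : ProbabilityMeasure X} {Qn : ℕ → ProbabilityMeasure X} (hQ : Tendsto Qn atTop (𝓝 Q)) :
    Tendsto (fun n ↦ compProdProba (Qn n) ν) atTop (𝓝 (compProdProba Q ν)) := by
  rw [ProbabilityMeasure.tendsto_iff_forall_integral_tendsto]
  intro F
  have hF {R : Measure (X × Y)} [IsFiniteMeasure R] : Integrable F R := F.integrable R
  have hprod := ProbabilityMeasure.continuous_prod.comp (continuous_diracProba.prodMk hν)
  have hcont : Continuous fun x ↦ ∫ y, F (x, y) ∂(ν x) := by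
    have heq (x : X) : ∫ y, F (x, y) ∂(ν x) =
        ∫ z, F z ∂((diracProba x).prod (kernelProba ν x) : Measure (X × Y)) := by
      rw [ProbabilityMeasure.toMeasure_prod, integral_prod _ hF]
      exact (integral_dirac' (fun x' ↦ ∫ y, F (x', y) ∂(ν x)) x
        F.continuous.stronglyMeasurable.integral_prod_right').symm
    simp_rw [heq, continuous_iff_continuousAt]
    exact fun x ↦ ProbabilityMeasure.tendsto_iff_forall_integral_tendsto.1 (hprod.tendsto x) F
  let G : X →ᵇ ℝ := BoundedContinuousFunction.ofNormedAddCommGroup _ hcont ‖F‖ fun x ↦ by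
    simpa using norm_integral_le_of_norm_le_const (μ := ν x) (f := fun y ↦ F (x, y))
      (ae_of_all _ fun y ↦ F.norm_coe_le_norm (x, y))
  have := ProbabilityMeasure.tendsto_iff_forall_integral_tendsto.1 hQ G
  simpa [compProdProba, Measure.integral_compProd hF] using! this

end CompProd

/-- lower semicontinuity of the input-output mutual information: if `ν` is a
weakly continuous Markov kernel and `Q_n ⇒ Q` weakly, then
`liminf_n D(Q_n ⊗ ν ‖ Q_n × M_{Q_n}) ≥ D(Q ⊗ ν ‖ Q × M_Q)`, where `M_Q` is the output
marginal of `Q ⊗ ν`. -/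
theorem liminf_klDiv_compProd_ge
    {X Y : Type*}
    [MetricSpace X] [TopologicalSpace.SeparableSpace X]
    [MeasurableSpace X] [BorelSpace X]
    [MetricSpace Y] [TopologicalSpace.SeparableSpace Y]
    [MeasurableSpace Y] [BorelSpace Y]
    (ν : Kernel X Y) [IsMarkovKernel ν]
    (hν : ∀ (x : X) (u : ℕ → X), Tendsto u atTop (nhds x) →
      ∀ g : BoundedContinuousFunction Y ℝ,
        Tendsto (fun n => ∫ y, g y ∂(ν (u n))) atTop (nhds (∫ y, g y ∂(ν x))))
    (Q : Measure X) [IsProbabilityMeasure Q]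
    (Qn : ℕ → Measure X) [∀ n, IsProbabilityMeasure (Qn n)]
    (hQ : ∀ f : BoundedContinuousFunction X ℝ,
      Tendsto (fun n => ∫ x, f x ∂(Qn n)) atTop (nhds (∫ x, f x ∂Q))) :
    klDiv (Q ⊗ₘ ν) (Q.prod ((Q ⊗ₘ ν).map Prod.snd)) ≤
      Filter.liminf
        (fun n => klDiv (Qn n ⊗ₘ ν) ((Qn n).prod ((Qn n ⊗ₘ ν).map Prod.snd))) atTop := by
  have : SecondCountableTopology X := UniformSpace.secondCountable_of_separable X
  have : SecondCountableTopology Y := UniformSpace.secondCountable_of_separable Y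
  have hcont : Continuous (kernelProba ν) := by
    refine continuous_iff_seqContinuous.2 fun u x hu ↦ ?_
    exact ProbabilityMeasure.tendsto_iff_forall_integral_tendsto.2 (hν x u hu)
  let Q' : ProbabilityMeasure X := ⟨Q, inferInstance⟩
  let Qn' : ℕ → ProbabilityMeasure X := fun n ↦ ⟨Qn n, inferInstance⟩
  have hQ' : Tendsto Qn' atTop (nhds Q') :=
    ProbabilityMeasure.tendsto_iff_forall_integral_tendsto.2 hQ
  have hjoint := tendsto_compProdProba ν hcont hQ'
  have hsnd := ProbabilityMeasure.tendsto_map_of_tendsto_of_continuous _ _ hjoint continuous_snd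
  have hprod := ((ProbabilityMeasure.continuous_prod (α := X) (β := Y)).tendsto (Q', _)).comp
    (hQ'.prodMk_nhds hsnd)
  have hmap (R : Measure X) [IsProbabilityMeasure R] :
      IsProbabilityMeasure ((R ⊗ₘ ν).map Prod.snd) :=
    Measure.isProbabilityMeasure_map measurable_snd.aemeasurable
  simp only [klDiv_eq_informationTheory_klDiv]
  exact klDiv_le_liminf_klDiv hjoint hprod
end

section
/- Let P > 0, let Q = N(0, P) be the centered Gaussian measure on ℝ with variance P, and let ν be the Markov kernel ν(x) = N(x, 1). Then the output marginal satisfies ν ∘ Q = N(0, P+1), and the mutual information of the Gaussian input on the AWGN channel equals the Shannon capacity: D(Q ⊗ ν ‖ Q × N(0, P+1)) = (1/2)·log(1 + P) (in nats). -/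
open MeasureTheory ProbabilityTheory Filter
open scoped ProbabilityTheory ENNReal Classical NNReal

lemma compProd_gaussianReal_eq_map_prod (μ : Measure ℝ) [SFinite μ] (v : ℝ≥0)
    (ν : Kernel ℝ ℝ) [IsSFiniteKernel ν] (hν : ∀ x : ℝ, ν x = gaussianReal x v) :
    μ ⊗ₘ ν = (μ.prod (gaussianReal 0 v)).map (fun p ↦ (p.1, p.1 + p.2)) := by
  have hm : Measurable (fun p : ℝ × ℝ ↦ (p.1, p.1 + p.2)) := by fun_prop
  ext s hs
  rw [Measure.compProd_apply hs, Measure.map_apply hm hs, Measure.prod_apply (hm hs)]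
  refine lintegral_congr fun x ↦ ?_
  have h : gaussianReal x v = (gaussianReal 0 v).map (x + ·) := by
    rw [gaussianReal_map_const_add, zero_add]
  rw [hν, h, Measure.map_apply (by fun_prop) (measurable_prodMk_left hs)]
  rfl

/-- The log-likelihood ratio of `N(x, 1)` with respect to `N(0, v)` at the point `y`. -/
noncomputable def gaussianLogRatio (v : ℝ≥0) (p : ℝ × ℝ) : ℝ :=
  1 / 2 * Real.log v - (p.2 - p.1) ^ 2 / 2 + p.2 ^ 2 / (2 * v)

lemma measurable_gaussianLogRatio (v : ℝ≥0) : Measurable (gaussianLogRatio v) := by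
  unfold gaussianLogRatio
  fun_prop

lemma gaussianPDFReal_one_eq_mul_exp {v : ℝ≥0} (hv : v ≠ 0) (x y : ℝ) :
    gaussianPDFReal x 1 y = gaussianPDFReal 0 v y * Real.exp (gaussianLogRatio v (x, y)) := by
  have hv' : (0 : ℝ) < v := by positivity
  have hlog : Real.exp (1 / 2 * Real.log v) = √(v : ℝ) := by
    rw [Real.sqrt_eq_rpow, Real.rpow_def_of_pos hv', mul_comm]
  have hexp : Real.exp (gaussianLogRatio v (x, y)) =
      √(v : ℝ) * Real.exp (-(y - x) ^ 2 / 2) * Real.exp (y ^ 2 / (2 * v)) := by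
    rw [← hlog, ← Real.exp_add, ← Real.exp_add]
    congr 1
    simp only [gaussianLogRatio]
    ring
  have hcancel : Real.exp (-y ^ 2 / (2 * v)) * Real.exp (y ^ 2 / (2 * v)) = 1 := by
    rw [← Real.exp_add, neg_div, neg_add_cancel, Real.exp_zero]
  have hsqrt : √(v : ℝ) ≠ 0 := (Real.sqrt_pos.2 hv').ne'
  rw [hexp, gaussianPDFReal, gaussianPDFReal, Real.sqrt_mul (by positivity) (v : ℝ), mul_inv]
  simp only [NNReal.coe_one, mul_one, sub_zero]
  calc _ = (√(2 * Real.pi))⁻¹ * ((√(v : ℝ))⁻¹ * √(v : ℝ)) * Real.exp (-(y - x) ^ 2 / 2) *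
        (Real.exp (-y ^ 2 / (2 * v)) * Real.exp (y ^ 2 / (2 * v))) := by
        rw [hcancel, inv_mul_cancel₀ hsqrt, mul_one, mul_one]
    _ = _ := by ring

lemma gaussianReal_one_eq_withDensity {v : ℝ≥0} (hv : v ≠ 0) (x : ℝ) :
    gaussianReal x 1 = (gaussianReal 0 v).withDensity
      (fun y ↦ ENNReal.ofReal (Real.exp (gaussianLogRatio v (x, y)))) := by
  have hL : Measurable (fun y ↦ ENNReal.ofReal (Real.exp (gaussianLogRatio v (x, y)))) :=
    ((measurable_gaussianLogRatio v).comp measurable_prodMk_left).exp.ennreal_ofReal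
  rw [gaussianReal_of_var_ne_zero x one_ne_zero, gaussianReal_of_var_ne_zero 0 hv,
    ← withDensity_mul _ (measurable_gaussianPDF 0 v) hL]
  congr 1
  ext y
  simp only [Pi.mul_apply, gaussianPDF, gaussianPDFReal_one_eq_mul_exp hv x y]
  rw [ENNReal.ofReal_mul (gaussianPDFReal_nonneg _ _ _)]

lemma compProd_gaussianReal_one_eq_withDensity (μ : Measure ℝ) [SFinite μ]
    {v : ℝ≥0} (hv : v ≠ 0)
    (ν : Kernel ℝ ℝ) [IsSFiniteKernel ν] (hν : ∀ x : ℝ, ν x = gaussianReal x 1) :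
    μ ⊗ₘ ν = (μ.prod (gaussianReal 0 v)).withDensity
      (fun p ↦ ENNReal.ofReal (Real.exp (gaussianLogRatio v p))) := by
  have hL : Measurable (fun p ↦ ENNReal.ofReal (Real.exp (gaussianLogRatio v p))) :=
    (measurable_gaussianLogRatio v).exp.ennreal_ofReal
  ext s hs
  rw [Measure.compProd_apply hs, withDensity_apply _ hs, ← lintegral_indicator hs,
    lintegral_prod _ (hL.indicator hs).aemeasurable]
  refine lintegral_congr fun x ↦ ?_
  have hsx := measurable_prodMk_left (x := x) hs
  rw [hν, gaussianReal_one_eq_withDensity hv x, withDensity_apply _ hsx,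
    ← lintegral_indicator hsx]
  rfl

lemma llr_withDensity_exp {α : Type*} [MeasurableSpace α] (μ : Measure α) [SigmaFinite μ]
    {f : α → ℝ} (hf : Measurable f) :
    llr (μ.withDensity fun x ↦ ENNReal.ofReal (Real.exp (f x))) μ =ᵐ[μ] f := by
  filter_upwards [μ.rnDeriv_withDensity hf.exp.ennreal_ofReal] with x hx
  rw [llr, hx, ENNReal.toReal_ofReal (Real.exp_pos _).le, Real.log_exp]

lemma integrable_sq_gaussianReal (m : ℝ) (v : ℝ≥0) :
    Integrable (fun x ↦ x ^ 2) (gaussianReal m v) :=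
  (memLp_id_gaussianReal 2).integrable_sq

lemma integral_sq_gaussianReal_zero (v : ℝ≥0) : ∫ x, x ^ 2 ∂(gaussianReal 0 v) = v := by
  have h := variance_fun_id_gaussianReal (μ := 0) (v := v)
  rw [variance_eq_integral (by fun_prop), integral_id_gaussianReal] at h
  simpa only [sub_zero] using h

lemma map_add_prod_gaussianReal (m₁ m₂ : ℝ) (v₁ v₂ : ℝ≥0) :
    ((gaussianReal m₁ v₁).prod (gaussianReal m₂ v₂)).map (fun p ↦ p.1 + p.2) =
      gaussianReal (m₁ + m₂) (v₁ + v₂) :=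
  gaussianReal_conv_gaussianReal

/-- for the AWGN channel `ν(x) = N(x,1)` with Gaussian input
`Q = N(0,P)`, `P > 0`, the output marginal is `N(0, P+1)` and the mutual information
`D(Q ⊗ ν ‖ Q × N(0,P+1))` equals the Shannon capacity `(1/2)·log(1+P)` (in nats). -/
theorem gaussian_input_awgn_capacity
    (P : ℝ≥0) (hP : 0 < P)
    (ν : Kernel ℝ ℝ) [IsMarkovKernel ν] (hν : ∀ x : ℝ, ν x = gaussianReal x 1) :
    (gaussianReal 0 P ⊗ₘ ν).map Prod.snd = gaussianReal 0 (P + 1) ∧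
    klDiv (gaussianReal 0 P ⊗ₘ ν) ((gaussianReal 0 P).prod (gaussianReal 0 (P + 1))) =
      ENNReal.ofReal (1 / 2 * Real.log (1 + (P : ℝ))) := by
  have hmap := compProd_gaussianReal_eq_map_prod (gaussianReal 0 P) 1 ν hν
  have hm : Measurable (fun p : ℝ × ℝ ↦ (p.1, p.1 + p.2)) := by fun_prop
  have hsum : ((gaussianReal 0 P).prod (gaussianReal 0 1)).map (fun p ↦ p.1 + p.2) =
      gaussianReal 0 (P + 1) := by
    rw [map_add_prod_gaussianReal, add_zero]
  refine ⟨by rw [hmap, Measure.map_map measurable_snd hm]; exact hsum, ?_⟩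
  have hv : P + 1 ≠ 0 := by positivity
  have hL := measurable_gaussianLogRatio (P + 1)
  have hdens := compProd_gaussianReal_one_eq_withDensity (gaussianReal 0 P) hv ν hν
  have hac : gaussianReal 0 P ⊗ₘ ν ≪ (gaussianReal 0 P).prod (gaussianReal 0 (P + 1)) :=
    hdens ▸ withDensity_absolutelyContinuous _ _
  have hllr : llr (gaussianReal 0 P ⊗ₘ ν) ((gaussianReal 0 P).prod (gaussianReal 0 (P + 1)))
      =ᵐ[gaussianReal 0 P ⊗ₘ ν] gaussianLogRatio (P + 1) := by
    refine hac.ae_eq ?_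
    rw [hdens]
    exact llr_withDensity_exp _ hL
  have hcomp : (fun p : ℝ × ℝ ↦ gaussianLogRatio (P + 1) (p.1, p.1 + p.2)) = fun p ↦
      1 / 2 * Real.log (P + 1 : ℝ≥0) - p.2 ^ 2 / 2 + (p.1 + p.2) ^ 2 / (2 * (P + 1 : ℝ≥0)) := by
    ext p
    simp only [gaussianLogRatio, add_sub_cancel_left]
  have hsnd : Integrable (fun p : ℝ × ℝ ↦ p.2 ^ 2)
      ((gaussianReal 0 P).prod (gaussianReal 0 1)) :=
    (integrable_sq_gaussianReal 0 1).comp_snd _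
  have hadd : Integrable (fun p : ℝ × ℝ ↦ (p.1 + p.2) ^ 2)
      ((gaussianReal 0 P).prod (gaussianReal 0 1)) := by
    have h := integrable_sq_gaussianReal 0 (P + 1)
    rw [← hsum] at h
    exact h.comp_measurable (by fun_prop)
  have hadd_int : ∫ p : ℝ × ℝ, (p.1 + p.2) ^ 2 ∂((gaussianReal 0 P).prod (gaussianReal 0 1)) =
      (P + 1 : ℝ≥0) := by
    rw [← integral_sq_gaussianReal_zero (P + 1), ← hsum,
      integral_map (by fun_prop) (by fun_prop)]
  have hsnd_int : ∫ p : ℝ × ℝ, p.2 ^ 2 ∂((gaussianReal 0 P).prod (gaussianReal 0 1)) = 1 := by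
    rw [integral_fun_snd (fun z : ℝ ↦ z ^ 2), integral_sq_gaussianReal_zero]
    simp
  have hnoise : Integrable (fun p : ℝ × ℝ ↦ 1 / 2 * Real.log (P + 1 : ℝ≥0) - p.2 ^ 2 / 2)
      ((gaussianReal 0 P).prod (gaussianReal 0 1)) :=
    (integrable_const _).sub (hsnd.div_const _)
  have hint : Integrable (gaussianLogRatio (P + 1)) (gaussianReal 0 P ⊗ₘ ν) := by
    rw [hmap, integrable_map_measure hL.aestronglyMeasurable hm.aemeasurable]
    refine Integrable.congr ?_ (Eventually.of_forall fun p ↦ (congrFun hcomp p).symm)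
    exact hnoise.add (hadd.div_const _)
  have hval : ∫ p, gaussianLogRatio (P + 1) p ∂(gaussianReal 0 P ⊗ₘ ν) =
      1 / 2 * Real.log (1 + (P : ℝ)) := by
    rw [hmap, integral_map hm.aemeasurable hL.aestronglyMeasurable, hcomp,
      integral_add hnoise (hadd.div_const _),
      integral_sub (integrable_const _) (hsnd.div_const _), integral_div, integral_div,
      hadd_int, hsnd_int]
    have hpos : ((P + 1 : ℝ≥0) : ℝ) ≠ 0 := by exact_mod_cast hv
    rw [integral_const, probReal_univ, one_smul, div_mul_cancel_right₀ hpos, NNReal.coe_add,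
      NNReal.coe_one, add_comm (P : ℝ) 1]
    ring
  rw [klDiv, if_pos ⟨hac, hint.congr hllr.symm⟩, integral_congr_ae hllr, hval]
end

section
/- Gauss–Hermite weights form a probability distribution: for every m ≥ 1, summing over the multiset of real roots x of the probabilists' Hermite polynomial H_m (with multiplicity), Σ_x (m−1)! / ( m · H_{m−1}(x)² ) = 1. -/
open Polynomial

theorem derivative_hermite_succ (n : ℕ) :
    derivative (hermite (n + 1)) = (n + 1 : ℤ[X]) * hermite n := by
  induction n with
  | zero => simp
  | succ n ih =>
    have hd : derivative (hermite (n + 1) : ℤ[X]) = C ((n : ℤ) + 1) * hermite n := by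
      rw [ih]; simp
    rw [hermite_succ (n + 1), derivative_sub, derivative_mul, derivative_X, hd, derivative_C_mul,
      hermite_succ n]
    simp only [map_add, map_natCast, map_one]
    push_cast
    ring

theorem hermite_add_two (n : ℕ) :
    hermite (n + 2) = X * hermite (n + 1) - (n + 1 : ℤ[X]) * hermite n := by
  rw [hermite_succ (n + 1), derivative_hermite_succ]

/-- The associated (numerator) polynomials of the Hermite polynomials: the solution of the same
three-term recurrence with initial values `0` and `1`. -/
noncomputable def hermiteAssoc : ℕ → ℤ[X]
  | 0 => 0
  | 1 => 1
  | n + 2 => X * hermiteAssoc (n + 1) - (n + 1 : ℤ[X]) * hermiteAssoc n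

theorem hermiteAssoc_add_two (n : ℕ) :
    hermiteAssoc (n + 2) = X * hermiteAssoc (n + 1) - (n + 1 : ℤ[X]) * hermiteAssoc n := by
  rw [hermiteAssoc]

theorem hermiteAssoc_mul_hermite_sub (n : ℕ) :
    hermiteAssoc (n + 1) * hermite n - hermite (n + 1) * hermiteAssoc n
      = (n.factorial : ℤ[X]) := by
  induction n with
  | zero => simp [hermiteAssoc]
  | succ n ih =>
    rw [hermiteAssoc_add_two, hermite_add_two, Nat.factorial_succ]
    push_cast
    linear_combination (n + 1 : ℤ[X]) * ih

theorem coeff_hermiteAssoc_add_two_succ (n k : ℕ) : (hermiteAssoc (n + 2)).coeff (k + 1) =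
    (hermiteAssoc (n + 1)).coeff k - (n + 1) * (hermiteAssoc n).coeff (k + 1) := by
  have h : (n + 1 : ℤ[X]) = C ((n : ℤ) + 1) := by simp
  rw [hermiteAssoc_add_two, coeff_sub, coeff_X_mul, h, coeff_C_mul]

theorem coeff_hermiteAssoc_of_le {n k : ℕ} (h : n ≤ k) : (hermiteAssoc n).coeff k = 0 := by
  induction n using Nat.twoStepInduction generalizing k with
  | zero => simp [hermiteAssoc]
  | one => simp [hermiteAssoc, coeff_one, show k ≠ 0 by omega]
  | more n ih₀ ih₁ =>
    obtain ⟨k, rfl⟩ := Nat.exists_eq_succ_of_ne_zero (show k ≠ 0 by omega)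
    rw [Nat.succ_eq_add_one, coeff_hermiteAssoc_add_two_succ, ih₁ (by omega), ih₀ (by omega)]
    simp

theorem coeff_hermiteAssoc_succ_self (n : ℕ) : (hermiteAssoc (n + 1)).coeff n = 1 := by
  induction n with
  | zero => simp [hermiteAssoc]
  | succ n ih =>
    rw [coeff_hermiteAssoc_add_two_succ, ih, coeff_hermiteAssoc_of_le n.le_succ]
    simp

theorem degree_hermiteAssoc_lt (n : ℕ) : (hermiteAssoc n).degree < n :=
  (degree_lt_iff_coeff_zero _ _).2 fun _ => coeff_hermiteAssoc_of_le

/-- The Christoffel–Darboux identity for the Hermite polynomials. -/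
theorem christoffel_darboux_hermite {K : Type*} [Field K] [CharZero K] (z w : K) (n : ℕ) :
    (z - w) * ∑ k ∈ Finset.range (n + 1),
        aeval z (hermite k) * aeval w (hermite k) / (k.factorial : K) =
      (aeval z (hermite (n + 1)) * aeval w (hermite n)
        - aeval z (hermite n) * aeval w (hermite (n + 1))) / (n.factorial : K) := by
  induction n with
  | zero => simp
  | succ n ih =>
    have hn : (n.factorial : K) ≠ 0 := by exact_mod_cast n.factorial_ne_zero
    have hn' : (n + 1 : K) ≠ 0 := by exact_mod_cast n.succ_ne_zero
    rw [Finset.sum_range_succ, mul_add, ih, hermite_add_two, Nat.factorial_succ]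
    simp only [map_sub, map_mul, aeval_X, map_add, map_natCast, map_one]
    push_cast
    field_simp
    ring

theorem im_eq_zero_of_aeval_hermite_eq_zero {n : ℕ} {z : ℂ} (hz : aeval z (hermite n) = 0) :
    z.im = 0 := by
  cases n with
  | zero => simp at hz
  | succ n =>
    have hconj (k : ℕ) : aeval (starRingEnd ℂ z) (hermite k)
        = starRingEnd ℂ (aeval z (hermite k)) := by
      rw [aeval_def, aeval_def, hom_eval₂]
      congr 1
      exact RingHom.ext_int _ _
    have hcd := christoffel_darboux_hermite z (starRingEnd ℂ z) n
    simp only [hconj, hz, map_zero, zero_mul, mul_zero, sub_zero, zero_div, Complex.mul_conj]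
      at hcd
    have hpos : 0 < ∑ k ∈ Finset.range (n + 1),
        Complex.normSq (aeval z (hermite k)) / (k.factorial : ℝ) := by
      refine Finset.sum_pos' (fun k _ => ?_) ⟨0, by simp, by simp⟩
      exact div_nonneg (Complex.normSq_nonneg _) (Nat.cast_nonneg _)
    rcases mul_eq_zero.1 hcd with h | h
    · exact Complex.conj_eq_iff_im.1 (sub_eq_zero.1 h).symm
    · exact absurd (by exact_mod_cast h) hpos.ne'

theorem splits_map_hermite (n : ℕ) : ((hermite n).map (Int.castRingHom ℝ)).Splits := by
  refine Splits.of_splits_map_of_injective (i := Complex.ofRealHom) Complex.ofReal_injective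
    (IsAlgClosed.splits _) fun z hz => ?_
  have hz' : aeval z (hermite n) = 0 := by
    rw [Polynomial.map_map] at hz
    have := (mem_roots'.1 hz).2
    rw [IsRoot, eval_map] at this
    rw [aeval_def, ← this]
    congr 1
  exact ⟨z.re, Complex.ext rfl (by simp [im_eq_zero_of_aeval_hermite_eq_zero hz'])⟩

theorem separable_map_hermite (K : Type*) [Field K] [CharZero K] (n : ℕ) :
    ((hermite n).map (Int.castRingHom K)).Separable := by
  cases n with
  | zero => simp
  | succ n =>
    have h := congrArg (Polynomial.map (Int.castRingHom K)) (hermiteAssoc_mul_hermite_sub n)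
    have hn : (n.factorial : K) ≠ 0 := by exact_mod_cast n.factorial_ne_zero
    have hn' : (n + 1 : K) ≠ 0 := by exact_mod_cast n.succ_ne_zero
    have h₁ : C (n.factorial : K)⁻¹ * (n.factorial : K[X]) = 1 := by
      rw [← C_eq_natCast, ← C_mul, inv_mul_cancel₀ hn, C_1]
    have h₂ : C (n + 1 : K)⁻¹ * (n + 1 : K[X]) = 1 := by
      rw [← C_eq_natCast, ← C_1, ← C_add, ← C_mul, inv_mul_cancel₀ hn']
    simp only [Polynomial.map_sub, Polynomial.map_mul, Polynomial.map_natCast] at h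
    refine ⟨-(C (n.factorial : K)⁻¹ * (hermiteAssoc n).map (Int.castRingHom K)),
      C (n + 1 : K)⁻¹ * C (n.factorial : K)⁻¹ *
        (hermiteAssoc (n + 1)).map (Int.castRingHom K), ?_⟩
    rw [derivative_map, derivative_hermite_succ]
    simp only [Polynomial.map_mul, Polynomial.map_add, Polynomial.map_natCast,
      Polynomial.map_one]
    linear_combination C (n.factorial : K)⁻¹ * h + h₁ +
      C (n.factorial : K)⁻¹ * (hermiteAssoc (n + 1)).map (Int.castRingHom K) *
        (hermite n).map (Int.castRingHom K) * h₂

/-- If `p` is a monic separable split polynomial and `q` has smaller degree, then the sum of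
`q / p'` over the roots of `p` is the coefficient of `q` in degree `p.natDegree - 1`. -/
theorem sum_roots_eval_div_eval_derivative {K : Type*} [Field K] {p q : K[X]} (hp : p.Monic)
    (hs : p.Splits) (hsep : p.Separable) (hq : q.degree < p.natDegree) :
    (p.roots.map fun x => q.eval x / (derivative p).eval x).sum
      = q.coeff (p.natDegree - 1) := by
  classical
  have hnd : p.roots.Nodup := nodup_roots hsep
  let s : Finset K := ⟨p.roots, hnd⟩
  have hcard : s.card = p.natDegree := hs.natDegree_eq_card_roots.symm
  have hnodal : Lagrange.nodal s id = p := by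
    conv_rhs => rw [hs.eq_prod_roots_of_monic hp]
    rfl
  have hsum := Lagrange.coeff_eq_sum (s := s) (v := id) Function.injective_id.injOn
    (hcard.symm ▸ hq)
  rw [← hcard, hsum]
  change ∑ x ∈ s, _ = _
  refine Finset.sum_congr rfl fun x hx => ?_
  have := Lagrange.eval_nodal_derivative_eval_node_eq (v := id) hx
  rw [hnodal, Lagrange.eval_nodal] at this
  exact congrArg _ this

/-- the Gauss–Hermite weights form a probability distribution: for
`m ≥ 1`, summing over the multiset of real roots `x` of the probabilists' Hermite
polynomial `H_m` (with multiplicity), `Σ_x (m−1)!/(m·H_{m−1}(x)²) = 1`. -/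
theorem gauss_hermite_weights_sum_to_one (m : ℕ) (hm : 1 ≤ m) :
    ((((hermite m).map (Int.castRingHom ℝ)).roots).map
        (fun x => (Nat.factorial (m - 1) : ℝ) / (m * (aeval x (hermite (m - 1))) ^ 2))).sum
      = 1 := by
  obtain ⟨n, rfl⟩ : ∃ n, m = n + 1 := ⟨m - 1, by omega⟩
  have hdeg : ((hermite (n + 1)).map (Int.castRingHom ℝ)).natDegree = n + 1 := by
    rw [(hermite_monic _).natDegree_map, natDegree_hermite]
  have hsum := sum_roots_eval_div_eval_derivative
    (q := (hermiteAssoc (n + 1)).map (Int.castRingHom ℝ))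
    ((hermite_monic (n + 1)).map (Int.castRingHom ℝ)) (splits_map_hermite _)
    (separable_map_hermite ℝ _)
    (by rw [hdeg]; exact degree_map_le.trans_lt (degree_hermiteAssoc_lt _))
  rw [hdeg, Nat.add_sub_cancel, coeff_map, coeff_hermiteAssoc_succ_self, map_one] at hsum
  rw [← hsum, Nat.add_sub_cancel]
  refine congrArg _ (Multiset.map_congr rfl fun x hx => ?_)
  have heval (p : ℤ[X]) : (p.map (Int.castRingHom ℝ)).eval x = aeval x p := by
    rw [eval_map, aeval_def]
    rfl
  have hroot : aeval x (hermite (n + 1)) = 0 := heval _ ▸ (mem_roots'.1 hx).2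
  have hw := congrArg (aeval x) (hermiteAssoc_mul_hermite_sub n)
  simp only [map_sub, map_mul, hroot, zero_mul, sub_zero, map_natCast] at hw
  have hn : (n.factorial : ℝ) ≠ 0 := by exact_mod_cast n.factorial_ne_zero
  have hne : aeval x (hermite n) ≠ 0 := right_ne_zero_of_mul (hw ▸ hn)
  rw [derivative_map, derivative_hermite_succ, heval, heval, ← hw]
  simp only [map_mul, map_add, map_natCast, map_one]
  push_cast
  field_simp
end
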